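/- Let n, d be positive integers, N = n·d, let S ∈ ℂ^{n×N} be the decimation matrix with factor d, and let F_N be the N×N unitary DFT matrix. Then F_N·Sᴴ S·F_Nᴴ = (1/d)·(J_d ⊗ I_n). -/

import Mathlib

open Matrix Kronecker

/-- The decimation matrix `S ∈ ℂ^{n × nd}` with factor `d`:
`S i j = 1` if `j = d·i` and `0` otherwise. -/
def decim (n d : ℕ) : Matrix (Fin n) (Fin (n * d)) ℂ :=
  Matrix.of fun i j => if (j : ℕ) = d * (i : ℕ) then 1 else 0

/-- The unitary DFT matrix of size `N`. -/
noncomputable def dftMatrix (N : ℕ) : Matrix (Fin N) (Fin N) ℂ :=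
  Matrix.of fun j k => ((Real.sqrt N : ℝ) : ℂ)⁻¹ *
    Complex.exp ((-2 : ℂ) * (Real.pi : ℂ) * Complex.I * (j : ℕ) * (k : ℕ) / (N : ℂ))

/-- The all-ones matrix `J_d`. -/
def onesMatrix (d : ℕ) : Matrix (Fin d) (Fin d) ℂ :=
  Matrix.of fun _ _ => (1 : ℂ)

/-- A geometric sum of quotients of powers of a primitive `n`-th root of unity. -/
theorem IsPrimitiveRoot.sum_pow_mul_inv_pow {K : Type*} [Field K] {n : ℕ} {ζ : K}
    (hζ : IsPrimitiveRoot ζ n) (hn : n ≠ 0) (p q : ℕ) :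
    ∑ i : Fin n, (ζ ^ q * (ζ ^ p)⁻¹) ^ (i : ℕ) = if p % n = q % n then (n : K) else 0 := by
  have hp : ζ ^ p ≠ 0 := pow_ne_zero _ (hζ.ne_zero hn)
  have hone : ζ ^ q * (ζ ^ p)⁻¹ = 1 ↔ p % n = q % n := by
    rw [← div_eq_mul_inv, div_eq_one_iff_eq hp, (hζ.isOfFinOrder hn).pow_inj_mod,
      ← hζ.eq_orderOf, eq_comm]
  have hpow : (ζ ^ q * (ζ ^ p)⁻¹) ^ n = 1 := by
    rw [mul_pow, inv_pow, pow_right_comm, pow_right_comm ζ p, hζ.pow_eq_one]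
    simp
  rw [Fin.sum_univ_eq_sum_range (fun i => (ζ ^ q * (ζ ^ p)⁻¹) ^ i)]
  split_ifs with h
  · simp [hone.2 h]
  · rw [geom_sum_eq (mt hone.1 h), hpow, sub_self, zero_div]

/-- The entries of `F_N·Sᴴ` as powers of the primitive `n`-th root of unity. -/
theorem dftMatrix_mul_decim_conjTranspose_apply {n d : ℕ} (hn : 0 < n) (hd : 0 < d)
    (p : Fin (n * d)) (i : Fin n) :
    (dftMatrix (n * d) * (decim n d)ᴴ) p i = ((Real.sqrt (n * d : ℕ) : ℝ) : ℂ)⁻¹ *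
      ((Complex.exp (2 * Real.pi * Complex.I / n) ^ (p : ℕ))⁻¹) ^ (i : ℕ) := by
  have hlt : d * (i : ℕ) < n * d := by
    rw [mul_comm n]; exact Nat.mul_lt_mul_of_pos_left i.2 hd
  have hn' : (n : ℂ) ≠ 0 := by exact_mod_cast hn.ne'
  have hd' : (d : ℂ) ≠ 0 := by exact_mod_cast hd.ne'
  rw [Matrix.mul_apply, Finset.sum_eq_single (⟨d * i, hlt⟩ : Fin (n * d))]
  · simp only [dftMatrix, decim, Matrix.of_apply, Matrix.conjTranspose_apply, if_true, star_one,
      mul_one]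
    rw [← Complex.exp_nat_mul, ← Complex.exp_neg, ← Complex.exp_nat_mul]
    congr 2
    push_cast
    field_simp
  · intro j _ hj
    have : (j : ℕ) ≠ d * i := fun h => hj (Fin.ext h)
    simp [decim, this]
  · simp

/-- `F_N·Sᴴ S·F_Nᴴ = (1/d)·(J_d ⊗ I_n)` for the decimation matrix `S` with factor `d`
and the unitary DFT matrix `F_N`, `N = n·d` (with the natural identification of
`Fin d × Fin n` with `Fin (n·d)`). -/
theorem dft_decim_conj (n d : ℕ) (hn : 0 < n) (hd : 0 < d) :
    dftMatrix (n * d) * ((decim n d)ᴴ * decim n d) * (dftMatrix (n * d))ᴴ =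
      Matrix.reindex (finProdFinEquiv.trans (finCongr (Nat.mul_comm d n)))
        (finProdFinEquiv.trans (finCongr (Nat.mul_comm d n)))
        (((d : ℂ)⁻¹) • (onesMatrix d ⊗ₖ (1 : Matrix (Fin n) (Fin n) ℂ))) := by
  have hζ := Complex.isPrimitiveRoot_exp n hn.ne'
  have hn' : (n : ℂ) ≠ 0 := by exact_mod_cast hn.ne'
  have hd' : (d : ℂ) ≠ 0 := by exact_mod_cast hd.ne'
  have hfac : dftMatrix (n * d) * ((decim n d)ᴴ * decim n d) * (dftMatrix (n * d))ᴴ =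
      (dftMatrix (n * d) * (decim n d)ᴴ) * (dftMatrix (n * d) * (decim n d)ᴴ)ᴴ := by
    simp only [Matrix.conjTranspose_mul, Matrix.conjTranspose_conjTranspose, Matrix.mul_assoc]
  have hstar : star (Complex.exp (2 * Real.pi * Complex.I / n)) =
      (Complex.exp (2 * Real.pi * Complex.I / n))⁻¹ := by
    rw [← Complex.exp_neg, Complex.star_def, ← Complex.exp_conj]
    congr 1
    simp [neg_div, Complex.conj_ofNat]
  have hsqrt : ((Real.sqrt (n * d : ℕ) : ℝ) : ℂ)⁻¹ * ((Real.sqrt (n * d : ℕ) : ℝ) : ℂ)⁻¹ =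
      ((n : ℂ) * d)⁻¹ := by
    rw [← mul_inv, ← Complex.ofReal_mul, Real.mul_self_sqrt (Nat.cast_nonneg _)]
    push_cast
    rfl
  have hreal : star (((Real.sqrt (n * d : ℕ) : ℝ) : ℂ)⁻¹) =
      ((Real.sqrt (n * d : ℕ) : ℝ) : ℂ)⁻¹ := by
    rw [star_inv₀, Complex.star_def, Complex.conj_ofReal]
  ext p q
  have hlhs : (dftMatrix (n * d) * ((decim n d)ᴴ * decim n d) * (dftMatrix (n * d))ᴴ) p q =
      ((n : ℂ) * d)⁻¹ * if (p : ℕ) % n = (q : ℕ) % n then (n : ℂ) else 0 := by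
    rw [hfac, Matrix.mul_apply, ← hζ.sum_pow_mul_inv_pow hn.ne', Finset.mul_sum]
    refine Finset.sum_congr rfl fun i _ => ?_
    rw [Matrix.conjTranspose_apply, dftMatrix_mul_decim_conjTranspose_apply hn hd,
      dftMatrix_mul_decim_conjTranspose_apply hn hd, star_mul', hreal, star_pow, star_inv₀,
      star_pow, hstar, ← hsqrt, inv_pow _ (q : ℕ), inv_inv, mul_pow]
    ring
  rw [hlhs]
  simp only [Matrix.reindex_apply, Matrix.submatrix_apply, Matrix.smul_apply,
    Matrix.kroneckerMap_apply, onesMatrix, Matrix.of_apply, Matrix.one_apply, one_mul,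
    Equiv.symm_trans_apply, finProdFinEquiv_symm_apply, Fin.ext_iff, Fin.coe_modNat,
    finCongr_symm, finCongr_apply, Fin.val_cast, smul_eq_mul]
  split_ifs
  · field_simp
  · simp only [mul_zero]
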